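/- Let e ≥ 2 and r ≥ 2 be integers. Suppose c ≤ d are integers and let u_1 > … > u_n be the elements of {c, c+1, …, d} ∩ 𝟙_r in decreasing order. Then there exists a scalar α ∈ ℚ(q) such that, in the n-wedge space Λ^n_{e,r}, |u_n⟩∧|u_{n−1}⟩∧…∧|u_1⟩ = α · (|u_1⟩∧|u_2⟩∧…∧|u_n⟩). -/

import Mathlib

noncomputable section

/-- The field `ℚ(q)` of rational functions. -/
abbrev K : Type := RatFunc ℚ

/-- The element `q` of `ℚ(q)`. -/
def qK : K := RatFunc.X

/-- `a_{r'}(t)`: the unique element of `{1,…,e}` congruent to `t` modulo `e`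
(this does not depend on `r'`). -/
def aFun (e t : ℤ) : ℤ := (t - 1) % e + 1

/-- `b_{r'}(t)`: the unique element of `{1,…,r'}` such that
`t = a_{r'}(t) + e (b_{r'}(t) − 1) − e r' m` for some integer `m`. -/
def bFun (e r t : ℤ) : ℤ := (t - 1) % (e * r) / e + 1

/-- `m_{r'}(t)`: the unique integer with
`t = a_{r'}(t) + e (b_{r'}(t) − 1) − e r' m_{r'}(t)`. -/
def mFun (e r t : ℤ) : ℤ := (aFun e t + e * (bFun e r t - 1) - t) / (e * r)

/-- The free `ℚ(q)`-module on the set of `l`-tuples of integers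
(the basis element at `(t₁,…,t_l)` is the formal wedge `|t₁⟩∧…∧|t_l⟩`). -/
abbrev FW (l : ℕ) := (Fin l → ℤ) →₀ K

/-- The formal two-entry wedge `|x⟩∧|y⟩` in the free module on pairs. -/
def pairTerm (x y : ℤ) : (ℤ × ℤ) →₀ K := Finsupp.single (x, y) 1

/-- The sum `Σ_{m ≥ m0} coeff m · |u−γ−Nm⟩∧|t+γ+Nm⟩`, where `m` ranges only over those
values for which the displayed wedge is ordered (first entry strictly bigger).  Since
`N ≥ 2` and `γ ≥ 0` in all uses, all such `m` satisfy `m ≤ (u−t).toNat`, so the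
following finite sum captures all of them. -/
def pairSum (N t u γ : ℤ) (m0 : ℕ) (coeff : ℕ → K) : (ℤ × ℤ) →₀ K :=
  ∑ m ∈ Finset.Ico m0 ((u - t).toNat + 1),
    if t + γ + N * m < u - γ - N * m then coeff m • pairTerm (u - γ - N * m) (t + γ + N * m)
    else 0

/-- For `t ≤ u`, the right-hand side of the straightening relation for `|t⟩∧|u⟩`
in the wedge space with parameters `e, r`. -/
def pairRHS (e r t u : ℤ) : (ℤ × ℤ) →₀ K :=
  let N := e * r
  let α := (aFun e u - aFun e t) % N
  let β := (e * (bFun e r u - bFun e r t)) % N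
  if α = 0 ∧ β = 0 then -pairTerm u t
  else if β = 0 then
    -(qK⁻¹ • pairTerm u t) +
      (qK ^ (-2 : ℤ) - 1) •
        (pairSum N t u α 0 (fun m => qK ^ (-2 * (m : ℤ))) -
          pairSum N t u 0 1 (fun m => qK ^ (1 - 2 * (m : ℤ))))
  else if α = 0 then
    -(qK • pairTerm u t) +
      (qK ^ (2 : ℤ) - 1) •
        (pairSum N t u β 0 (fun m => qK ^ (2 * (m : ℤ))) -
          pairSum N t u 0 1 (fun m => qK ^ (2 * (m : ℤ) - 1)))
  else
    -pairTerm u t +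
      (qK - qK⁻¹) • pairSum N t u β 0
        (fun m => (qK ^ (2 * (m : ℤ) + 1) + qK ^ (-2 * (m : ℤ) - 1)) / (qK + qK⁻¹)) +
      (qK⁻¹ - qK) • pairSum N t u α 0
        (fun m => (qK ^ (2 * (m : ℤ) + 1) + qK ^ (-2 * (m : ℤ) - 1)) / (qK + qK⁻¹)) +
      (qK - qK⁻¹) • pairSum N t u (α + β) 0
        (fun m => (qK ^ (2 * (m : ℤ) + 2) - qK ^ (-2 * (m : ℤ) - 2)) / (qK + qK⁻¹)) +
      (qK⁻¹ - qK) • pairSum N t u 0 1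
        (fun m => (qK ^ (2 * (m : ℤ)) - qK ^ (-2 * (m : ℤ))) / (qK + qK⁻¹))

/-- Replace the entries of an `l`-tuple at positions `j` and `j+1` by `p.1` and `p.2`. -/
def updPair (l : ℕ) (ts : Fin l → ℤ) (j : ℕ) (p : ℤ × ℤ) : Fin l → ℤ :=
  fun i => if (i : ℕ) = j then p.1 else if (i : ℕ) = j + 1 then p.2 else ts i

/-- The set of straightening relators: for every `l`-tuple `ts` and every pair of
adjacent positions `j, j+1` with `ts j ≤ ts (j+1)`, the element
`|ts⟩ − (RHS of the straightening relation applied at positions j, j+1)`. -/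
def relSet (e r : ℤ) (l : ℕ) : Set (FW l) :=
  {x | ∃ (ts : Fin l → ℤ) (j j' : Fin l), (j' : ℕ) = (j : ℕ) + 1 ∧ ts j ≤ ts j' ∧
      x = Finsupp.single ts 1 -
        (pairRHS e r (ts j) (ts j')).sum fun p c => Finsupp.single (updPair l ts (j : ℕ) p) c}

/-- The `l`-wedge space `Λ^l_{e,r}`: the quotient of the free module on `l`-tuples by
the straightening relations. -/
abbrev WedgeSpace (e r : ℤ) (l : ℕ) := FW l ⧸ Submodule.span K (relSet e r l)

/-- The image of the wedge `|ts 0⟩∧…∧|ts (l−1)⟩` in the `l`-wedge space. -/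
def wedge (e r : ℤ) (l : ℕ) (ts : Fin l → ℤ) : WedgeSpace e r l :=
  Submodule.Quotient.mk (Finsupp.single ts 1)

theorem bFun_eq_of_dvd {e r x y : ℤ} (h : e * r ∣ x - y) : bFun e r x = bFun e r y := by
  have h' : e * r ∣ (x - 1) - (y - 1) := by simpa using h
  rw [bFun, bFun, Int.emod_eq_emod_iff_emod_sub_eq_zero.mpr (Int.emod_eq_zero_of_dvd h')]

/-- An integer `t` with `b(t) = 1` is congruent to `a(t)` modulo `e r`. -/
theorem aFun_eq_of_bFun_eq_one {e r t : ℤ} (h : bFun e r t = 1) :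
    aFun e t = (t - 1) % (e * r) + 1 := by
  have h0 : (t - 1) % (e * r) / e = 0 := by simpa [bFun] using h
  rw [aFun, ← Int.emod_emod_of_dvd (t - 1) (dvd_mul_right e r)]
  congr 1
  have := Int.emod_add_mul_ediv ((t - 1) % (e * r)) e
  rw [h0, mul_zero, add_zero] at this
  exact this

theorem dvd_sub_aFun_sub {e r t u : ℤ}
    (ht : bFun e r t = 1) (hu : bFun e r u = 1) :
    e * r ∣ (u - t) - (aFun e u - aFun e t) % (e * r) := by
  have h : (aFun e u - aFun e t) % (e * r) = (u - t) % (e * r) := by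
    rw [aFun_eq_of_bFun_eq_one ht, aFun_eq_of_bFun_eq_one hu, add_sub_add_right_eq_sub,
      ← Int.sub_emod, sub_sub_sub_cancel_right]
  rw [h]
  exact Int.dvd_self_sub_emod

/-- The pairs that may occur when straightening `|t⟩∧|u⟩` with `b(t) = b(u) = 1`. -/
def straightenedPairs (e r t u : ℤ) : Set (ℤ × ℤ) :=
  {p | p.2 < p.1 ∧ p.1 ≤ u ∧ p.1 + p.2 = t + u ∧ bFun e r p.1 = 1 ∧ bFun e r p.2 = 1}

theorem pairTerm_mem_supported {s : Set (ℤ × ℤ)} {x y : ℤ} (h : (x, y) ∈ s) :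
    pairTerm x y ∈ Finsupp.supported K K s :=
  Finsupp.single_mem_supported K 1 h

theorem pairSum_mem_supported {e r t u γ : ℤ} (m0 : ℕ) (coeff : ℕ → K) (hN : 0 ≤ e * r)
    (hγ : 0 ≤ γ) (hu : bFun e r (u - γ) = 1) (ht : bFun e r (t + γ) = 1) :
    pairSum (e * r) t u γ m0 coeff ∈ Finsupp.supported K K (straightenedPairs e r t u) := by
  refine Submodule.sum_mem _ fun m _ => ?_
  split_ifs with h
  · refine Submodule.smul_mem _ _ (pairTerm_mem_supported ⟨h, ?_, ?_, ?_, ?_⟩)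
    · have : 0 ≤ e * r * m := by positivity
      simp only
      linarith
    · simp only
      ring
    · rw [← hu]
      exact bFun_eq_of_dvd ⟨-m, by ring⟩
    · rw [← ht]
      exact bFun_eq_of_dvd ⟨m, by ring⟩
  · exact Submodule.zero_mem _

theorem pairRHS_mem_supported {e r t u : ℤ} (he : 0 < e) (hr : 0 < r) (htu : t < u)
    (ht : bFun e r t = 1) (hu : bFun e r u = 1) :
    pairRHS e r t u ∈ Finsupp.supported K K (straightenedPairs e r t u) := by
  have hN : 0 < e * r := mul_pos he hr
  have hswap : pairTerm u t ∈ Finsupp.supported K K (straightenedPairs e r t u) :=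
    pairTerm_mem_supported ⟨htu, le_rfl, add_comm _ _, hu, ht⟩
  have hβ : (e * (bFun e r u - bFun e r t)) % (e * r) = 0 := by simp [ht, hu]
  obtain ⟨k, hk⟩ := dvd_sub_aFun_sub ht hu
  simp only [pairRHS, hβ, and_true, if_true]
  split_ifs with hα
  · exact Submodule.neg_mem _ hswap
  · refine Submodule.add_mem _ (Submodule.neg_mem _ (Submodule.smul_mem _ _ hswap))
      (Submodule.smul_mem _ _ (Submodule.sub_mem _ ?_ ?_))
    · refine pairSum_mem_supported _ _ hN.le (Int.emod_nonneg _ hN.ne') ?_ ?_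
      · rw [← ht]
        exact bFun_eq_of_dvd ⟨k, by linarith⟩
      · rw [← hu]
        exact bFun_eq_of_dvd ⟨-k, by linarith⟩
    · exact pairSum_mem_supported _ _ hN.le le_rfl (by simpa using hu) (by simpa using ht)

theorem wedge_eq_sum {e r : ℤ} {n : ℕ} (ts : Fin n → ℤ) (j j' : Fin n)
    (hj : (j' : ℕ) = (j : ℕ) + 1) (h : ts j ≤ ts j') :
    wedge e r n ts = (pairRHS e r (ts j) (ts j')).sum
      fun p c => c • wedge e r n (updPair n ts j p) := by
  have hmem := (Submodule.Quotient.mk_eq_zero _).mpr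
    (Submodule.subset_span (R := K) (s := relSet e r n) ⟨ts, j, j', hj, h, rfl⟩)
  rw [Submodule.Quotient.mk_sub, sub_eq_zero] at hmem
  rw [wedge, hmem, Finsupp.sum, Finsupp.sum, ← Submodule.mkQ_apply, map_sum]
  refine Finset.sum_congr rfl fun p _ => ?_
  rw [Submodule.mkQ_apply, wedge, ← Submodule.Quotient.mk_smul, Finsupp.smul_single, smul_eq_mul,
    mul_one]

theorem wedge_eq_zero {e r : ℤ} {n : ℕ} (ts : Fin n → ℤ) (j j' : Fin n)
    (hj : (j' : ℕ) = (j : ℕ) + 1) (h : ts j = ts j') : wedge e r n ts = 0 := by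
  have hts : updPair n ts j (ts j', ts j) = ts := by
    funext i
    unfold updPair
    split_ifs with h1 h2
    · rw [Fin.ext h1, h]
    · rw [Fin.ext (h2.trans hj.symm), h]
    · rfl
  have hw := wedge_eq_sum (e := e) (r := r) ts j j' hj h.le
  have hR : pairRHS e r (ts j) (ts j') = Finsupp.single (ts j', ts j) (-1) := by
    simp [pairRHS, h, pairTerm]
  rw [hR, Finsupp.sum_single_index (by simp), hts, neg_smul, one_smul] at hw
  have h2 : (2 : K) • wedge e r n ts = 0 := by
    rw [two_smul]
    exact eq_neg_iff_add_eq_zero.mp hw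
  exact (smul_eq_zero.mp h2).resolve_left two_ne_zero

theorem sum_mul_updPair {n : ℕ} (ts : Fin n → ℤ) (j j' : Fin n) (hj : (j' : ℕ) = (j : ℕ) + 1)
    {p : ℤ × ℤ} (hp : p.1 + p.2 = ts j + ts j') :
    ∑ i : Fin n, (i : ℤ) * updPair n ts j p i = (∑ i : Fin n, (i : ℤ) * ts i) + ts j - p.1 := by
  have hne : j ≠ j' := fun h => by simp [h] at hj
  have h1 : ∀ i : Fin n, (i : ℤ) * updPair n ts j p i = (i : ℤ) * ts i +
      ((if i = j then (j : ℤ) * (p.1 - ts j) else 0) +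
        if i = j' then (j' : ℤ) * (p.2 - ts j') else 0) := by
    intro i
    rcases eq_or_ne i j with rfl | h
    · simp [updPair, hne]
      ring
    · rcases eq_or_ne i j' with rfl | h'
      · simp [updPair, hj, hne.symm]
        ring
      · have h2 : (i : ℕ) ≠ j := fun hi => h (Fin.ext hi)
        have h3 : (i : ℕ) ≠ j + 1 := fun hi => h' (Fin.ext (hi.trans hj.symm))
        simp [updPair, h, h', h2, h3]
  simp only [h1, Finset.sum_add_distrib, Finset.sum_ite_eq', Finset.mem_univ, if_true, hj]
  push_cast
  linear_combination ((j : ℤ) + 1) * hp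

/-- Every wedge with entries in `{c,…,d} ∩ 𝟙_r` lies in the span of the ordered ones. -/
theorem wedge_mem_span_strictAnti {e r c d : ℤ} (he : 0 < e) (hr : 0 < r) {n : ℕ}
    (ts : Fin n → ℤ) (hts : ∀ i, ts i ∈ Set.Icc c d ∧ bFun e r (ts i) = 1) :
    wedge e r n ts ∈ Submodule.span K (Set.image (wedge e r n)
      {vs | StrictAnti vs ∧ ∀ i, vs i ∈ Set.Icc c d ∧ bFun e r (vs i) = 1}) := by
  induction hM : (∑ i : Fin n, (i : ℤ) * (ts i) - ∑ i : Fin n, (i : ℤ) * c).toNat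
    using Nat.strong_induction_on generalizing ts with
  | _ M ih =>
  by_cases hanti : StrictAnti ts
  · exact Submodule.subset_span ⟨ts, ⟨hanti, hts⟩, rfl⟩
  obtain ⟨j, j', hj, hle⟩ : ∃ j j' : Fin n, (j' : ℕ) = (j : ℕ) + 1 ∧ ts j ≤ ts j' := by
    by_contra! hcon
    refine hanti ?_
    cases n with
    | zero => exact fun i => i.elim0
    | succ n => exact Fin.strictAnti_iff_succ_lt.mpr fun i => hcon i.castSucc i.succ (by simp)
  rcases hle.eq_or_lt with heq | hlt
  · rw [wedge_eq_zero ts j j' hj heq]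
    exact Submodule.zero_mem _
  rw [wedge_eq_sum ts j j' hj hle]
  refine Submodule.sum_mem _ fun p hp => Submodule.smul_mem _ _ ?_
  obtain ⟨h1, h2, h3, h4, h5⟩ :=
    pairRHS_mem_supported he hr hlt (hts j).2 (hts j').2 (Finset.mem_coe.mpr hp)
  have hc := (hts j).1.1
  have hd := (hts j').1.2
  have hupd : ∀ i, updPair n ts j p i ∈ Set.Icc c d ∧ bFun e r (updPair n ts j p i) = 1 := by
    intro i
    unfold updPair
    split_ifs
    · exact ⟨⟨by linarith, by linarith⟩, h4⟩
    · exact ⟨⟨by linarith, by linarith⟩, h5⟩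
    · exact hts i
  refine ih _ ?_ _ hupd rfl
  have hpos : ∑ i : Fin n, (i : ℤ) * c ≤ ∑ i : Fin n, (i : ℤ) * updPair n ts j p i :=
    Finset.sum_le_sum fun i _ => mul_le_mul_of_nonneg_left (hupd i).1.1 (by positivity)
  have hsum := sum_mul_updPair ts j j' hj h3
  omega

theorem strictAnti_eq_of_mem_range {n : ℕ} {u v : Fin n → ℤ} (hu : StrictAnti u)
    (hv : StrictAnti v) (h : ∀ i, v i ∈ Set.range u) : v = u := by
  choose f hf using h
  have hmono : StrictMono f := fun i k hik => by
    rw [← hu.lt_iff_gt, hf, hf]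
    exact hv hik
  have hfid : f = id := by
    have hs := Finite.injective_iff_surjective.mp hmono.injective
    exact (StrictMono.range_inj hmono strictMono_id).mp (by simp [hs.range_eq])
  funext i
  rw [← hf i, hfid, id]

/-- With `u₁ > … > u_n` the elements of `{c,…,d} ∩ 𝟙_r`, the wedge
`|u_n⟩∧…∧|u₁⟩` is a scalar multiple of `|u₁⟩∧…∧|u_n⟩` in `Λ^n_{e,r}`. -/
theorem reversed_one_wedge_proportional (e r : ℤ) (he : 2 ≤ e) (hr : 2 ≤ r)
    (c d : ℤ) (hcd : c ≤ d) (n : ℕ)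
    (u : Fin n → ℤ) (hu : StrictAnti u)
    (huset : Set.range u = {x : ℤ | x ∈ Set.Icc c d ∧ bFun e r x = 1}) :
    ∃ α : K, wedge e r n (fun i => u i.rev) = α • wedge e r n u := by
  have he0 : 0 < e := by linarith
  have hr0 : 0 < r := by linarith
  have hmem : ∀ i, u i ∈ Set.Icc c d ∧ bFun e r (u i) = 1 := fun i =>
    huset.subset (Set.mem_range_self i)
  have hspan := wedge_mem_span_strictAnti he0 hr0 (fun i => u i.rev) fun i => hmem i.rev
  have hle : Submodule.span K (Set.image (wedge e r n)
      {vs | StrictAnti vs ∧ ∀ i, vs i ∈ Set.Icc c d ∧ bFun e r (vs i) = 1}) ≤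
      Submodule.span K {wedge e r n u} := by
    refine Submodule.span_mono ?_
    rintro _ ⟨vs, ⟨hvs, hv⟩, rfl⟩
    rw [strictAnti_eq_of_mem_range hu hvs fun i => huset.superset (hv i)]
    rfl
  obtain ⟨α, hα⟩ := Submodule.mem_span_singleton.mp (hle hspan)
  exact ⟨α, hα.symm⟩

end
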